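/- (Eventual polynomiality of the Hilbert function with regularity bound.) Let n ≥ 1, r ∈ ℕ, and let m : Fin r → (Fin n →₀ ℕ) be a family of exponent vectors. Let H(d) be the number of exponent vectors α with |α| = d such that for no i does m(i) ≤ α componentwise, and let L = |⊔_{i} m(i)| be the total degree of the componentwise maximum of all the m(i). Then there exists a polynomial P with rational coefficients of degree at most n − 1 such that for every d ∈ ℕ with L ≤ d + n − 1 (i.e., d ≥ L − n + 1), H(d) = P(d). -/

import Mathlib

/-- The number of exponents of total degree `d` divisible by `e`. -/
theorem card_finsuppAntidiag_filter_le {n d : ℕ} (hn : 1 ≤ n) (e : Fin n →₀ ℕ)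
    (h : e.degree ≤ d + n - 1) :
    (((Finset.univ : Finset (Fin n)).finsuppAntidiag d).filter (e ≤ ·)).card =
      (d + n - 1 - e.degree).choose (n - 1) := by
  by_cases hd : e.degree ≤ d
  · have key : ((Finset.univ : Finset (Fin n)).finsuppAntidiag d).filter (e ≤ ·) =
        ((Finset.univ : Finset (Fin n)).finsuppAntidiag (d - e.degree)).map
          (addRightEmbedding e) := by
      ext α
      simp only [Finset.mem_filter, Finset.mem_finsuppAntidiag, Finset.mem_map,
        addRightEmbedding_apply, Finset.subset_univ, and_true, ← Finsupp.degree_eq_sum]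
      constructor
      · rintro ⟨rfl, hle⟩
        refine ⟨α - e, ?_, tsub_add_cancel_of_le hle⟩
        have := congrArg Finsupp.degree (tsub_add_cancel_of_le hle)
        rw [map_add] at this
        omega
      · rintro ⟨β, hβ, rfl⟩
        refine ⟨?_, le_add_self⟩
        rw [map_add, hβ, Nat.sub_add_cancel hd]
    rw [key, Finset.card_map, Finset.card_finsuppAntidiag_nat_eq_choose, Finset.card_univ,
      Fintype.card_fin,
      show n + (d - e.degree) - 1 = (n - 1) + (d - e.degree) by omega, ← Nat.choose_symm_add]
    congr 1
    omega
  · rw [Nat.choose_eq_zero_of_lt (by omega), Finset.card_eq_zero, Finset.filter_eq_empty_iff]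
    intro α hα hle
    simp only [Finset.mem_finsuppAntidiag, Finset.subset_univ, and_true,
      ← Finsupp.degree_eq_sum] at hα
    exact hd (hα ▸ Finsupp.degree_mono hle)

/-- Inclusion-exclusion for the elements of a finite set lying above no `m i`. -/
theorem card_filter_forall_not_le {ι β R : Type*} [Fintype ι] [SemilatticeSup β] [OrderBot β]
    [DecidableLE β] [CommRing R] (A : Finset β) (m : ι → β)
    [DecidablePred fun α => ∀ i, ¬ m i ≤ α] :
    ((A.filter fun α => ∀ i, ¬ m i ≤ α).card : R) =
      ∑ S : Finset ι, (-1) ^ S.card * ((A.filter (S.sup m ≤ ·)).card : R) := by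
  classical
  have key (α : β) : (if ∀ i, ¬ m i ≤ α then (1 : R) else 0) =
      ∑ S : Finset ι, (-1) ^ S.card * if S.sup m ≤ α then 1 else 0 := by
    trans ∏ i, (1 + -(if m i ≤ α then (1 : R) else 0))
    · split_ifs with h
      · exact (Finset.prod_eq_one fun i _ => by simp [h i]).symm
      · push Not at h
        obtain ⟨i, hi⟩ := h
        exact (Finset.prod_eq_zero (Finset.mem_univ i) (by simp [hi])).symm
    · rw [Finset.prod_one_add, Finset.powerset_univ]
      refine Finset.sum_congr rfl fun S _ => ?_
      rw [Finset.prod_neg, Finset.prod_boole]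
      simp only [Finset.sup_le_iff]
      congr
  simp only [Finset.card_filter, Nat.cast_sum, Nat.cast_ite, Nat.cast_one, Nat.cast_zero, key,
    Finset.mul_sum]
  exact Finset.sum_comm

/-- The binomial coefficient `(x + c).choose k` as a polynomial in `x`. -/
noncomputable def shiftedChoose (k : ℕ) (c : ℚ) : Polynomial ℚ :=
  Polynomial.C (k.factorial : ℚ)⁻¹ * (descPochhammer ℚ k).comp (Polynomial.X + Polynomial.C c)

theorem natDegree_shiftedChoose_le (k : ℕ) (c : ℚ) : (shiftedChoose k c).natDegree ≤ k := by
  refine (Polynomial.natDegree_C_mul_le _ _).trans ?_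
  rw [Polynomial.natDegree_comp, descPochhammer_natDegree, Polynomial.natDegree_X_add_C, mul_one]

theorem eval_shiftedChoose (k : ℕ) {c x : ℚ} {N : ℕ} (h : x + c = N) :
    (shiftedChoose k c).eval x = N.choose k := by
  rw [shiftedChoose, Polynomial.eval_C_mul, Polynomial.eval_comp, Polynomial.eval_add,
    Polynomial.eval_X, Polynomial.eval_C, h, descPochhammer_eval_eq_descFactorial,
    Nat.descFactorial_eq_factorial_mul_choose, Nat.cast_mul,
    inv_mul_cancel_left₀ (by exact_mod_cast k.factorial_ne_zero)]

/-- eventual polynomiality of the Hilbert function with regularity bound: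
with `H d` the number of exponents of total degree `d` divisible by no `m i` and
`L = |⊔_i m i|`, there is a rational polynomial `P` of degree at most `n − 1` with
`H d = P d` for all `d` with `L ≤ d + n − 1`. -/
theorem stmt18 (n : ℕ) (hn : 1 ≤ n) (r : ℕ) (m : Fin r → (Fin n →₀ ℕ))
    (L : ℕ) (hL : L = Finsupp.degree (Finset.univ.sup m)) :
    ∃ P : Polynomial ℚ, P.natDegree ≤ n - 1 ∧
      ∀ d : ℕ, L ≤ d + n - 1 →
        ({α : Fin n →₀ ℕ | Finsupp.degree α = d ∧ ∀ i, ¬ m i ≤ α}.ncard : ℚ) =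
          P.eval (d : ℚ) := by
  classical
  refine ⟨∑ S : Finset (Fin r), Polynomial.C ((-1) ^ S.card) *
    shiftedChoose (n - 1) ((n : ℚ) - 1 - (S.sup m).degree), ?_, fun d hd => ?_⟩
  · exact Polynomial.natDegree_sum_le_of_forall_le _ _ fun S _ =>
      (Polynomial.natDegree_C_mul_le _ _).trans (natDegree_shiftedChoose_le _ _)
  · have hset : {α : Fin n →₀ ℕ | Finsupp.degree α = d ∧ ∀ i, ¬ m i ≤ α} =
        (((Finset.univ : Finset (Fin n)).finsuppAntidiag d).filter fun α => ∀ i, ¬ m i ≤ α :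
          Finset (Fin n →₀ ℕ)) := by
      ext α
      simp [Finsupp.degree_eq_sum]
    rw [hset, Set.ncard_coe_finset, card_filter_forall_not_le, Polynomial.eval_finsetSum]
    refine Finset.sum_congr rfl fun S _ => ?_
    have hS : (S.sup m).degree ≤ d + n - 1 :=
      (Finsupp.degree_mono (Finset.sup_mono (Finset.subset_univ S))).trans (hL ▸ hd)
    have hN : (d : ℚ) + ((n : ℚ) - 1 - (S.sup m).degree) =
        ((d + n - 1 - (S.sup m).degree : ℕ) : ℚ) := by
      rw [Nat.cast_sub hS, Nat.cast_sub (by omega)]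
      push_cast
      ring
    rw [card_finsuppAntidiag_filter_le hn _ hS, Polynomial.eval_C_mul, eval_shiftedChoose _ hN]
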